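/- Let G be a parity game and let L ⊆ V^ω be any set of infinite words over the vertex alphabet such that AllEvenCycles ⊆ L and L ∩ AllOddCycles = ∅. Then for every vertex v ∈ V, Eve wins the parity objective from v if and only if Eve wins the objective L from v. -/

import Mathlib

/-- A parity game: a finite directed graph in which every vertex has at least one
outgoing edge, a partition of vertices between Eve (`EveV`) and Adam (the complement),
and a priority function `c : V → {1, …, d}`. -/
structure ParityGame where
  V : Type
  [fintypeV : Fintype V]
  E : V → V → Prop
  exists_succ : ∀ v, ∃ w, E v w
  EveV : Set V
  d : ℕ
  c : V → ℕ
  c_pos : ∀ v, 1 ≤ c v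
  c_le_d : ∀ v, c v ≤ d

attribute [instance] ParityGame.fintypeV

namespace ParityGame

variable (G : ParityGame)

/-- A play from `v0`: an infinite sequence of vertices starting at `v0` and following edges. -/
def IsPlay (v0 : G.V) (π : ℕ → G.V) : Prop :=
  π 0 = v0 ∧ ∀ i, G.E (π i) (π (i + 1))

/-- The parity objective: the largest priority occurring infinitely often is even. -/
def SatParity (π : ℕ → G.V) : Prop :=
  Even (sSup {p | ∀ N, ∃ i, N ≤ i ∧ G.c (π i) = p})

/-- A strategy for Eve: maps a (finite) history together with the current vertex
(so together: a finite nonempty sequence of vertices ending in a vertex of `EveV`)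
to a next vertex, always following an edge. -/
structure EveStrategy (G : ParityGame) where
  move : List G.V → G.V → G.V
  follows : ∀ l v, v ∈ G.EveV → G.E v (move l v)

/-- A play is consistent with Eve's strategy `σ` if whenever `π i ∈ EveV`,
the next vertex is the one prescribed by `σ` applied to `π₀ … π_i`. -/
def ConsistentE (σ : EveStrategy G) (π : ℕ → G.V) : Prop :=
  ∀ i, π i ∈ G.EveV → π (i + 1) = σ.move ((List.range i).map π) (π i)

/-- Eve wins the objective `Ω` from `v0`. -/
def EveWinsObj (Ω : (ℕ → G.V) → Prop) (v0 : G.V) : Prop :=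
  ∃ σ : EveStrategy G, ∀ π, G.IsPlay v0 π → G.ConsistentE σ π → Ω π

/-- Eve wins (the parity objective) from `v0`. -/
def EveWinsFrom (v0 : G.V) : Prop :=
  G.EveWinsObj G.SatParity v0

end ParityGame

/-- A word `w ∈ V^ω` has all its cycles even: every infix `w_i, …, w_j` with `i < j` and
`w_i = w_j` has even maximal priority. -/
def ParityGame.AllEvenCycles (G : ParityGame) (w : ℕ → G.V) : Prop :=
  ∀ i j, i < j → w i = w j → Even ((Finset.Icc i j).sup fun k => G.c (w k))

/-- A word `w ∈ V^ω` has all its cycles odd: every infix `w_i, …, w_j` with `i < j` and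
`w_i = w_j` has odd maximal priority. -/
def ParityGame.AllOddCycles (G : ParityGame) (w : ℕ → G.V) : Prop :=
  ∀ i j, i < j → w i = w j → Odd ((Finset.Icc i j).sup fun k => G.c (w k))

namespace ParityGame

section Positional

variable {V : Type*} (E : V → V → Prop) (own : V → Bool) (c : V → ℕ)

/-- The largest number occurring infinitely often in `c ∘ w` exists and has parity `p`
(`false` for even, `true` for odd). -/
def Won (p : Bool) (w : ℕ → V) : Prop :=
  ∃ m : ℕ, m.bodd = p ∧ (∀ N, ∃ i, N ≤ i ∧ c (w i) = m) ∧ ∃ N, ∀ i, N ≤ i → c (w i) ≤ m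

/-- In the subgame on `S`, the player `p` can confine the play to `W`, and wins every play inside
`W`, by following the positional strategy `f`. -/
structure WinningRegion (S : Set V) (p : Bool) (W : Set V) (f : V → V) : Prop where
  subset : W ⊆ S
  move : ∀ v ∈ W, own v = p → E v (f v) ∧ f v ∈ W
  trap : ∀ v ∈ W, own v ≠ p → ∀ u ∈ S, E v u → u ∈ W
  won : ∀ w : ℕ → V, (∀ i, w i ∈ W) → (∀ i, E (w i) (w (i + 1))) →
    (∀ i, own (w i) = p → w (i + 1) = f (w i)) → Won c p w

variable {E own c}

theorem Won.of_shift {p : Bool} {w : ℕ → V} (k : ℕ) (h : Won c p fun i => w (i + k)) :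
    Won c p w := by
  obtain ⟨m, hm, hf, N, hN⟩ := h
  refine ⟨m, hm, fun M => ?_, N + k, fun i hi => ?_⟩
  · obtain ⟨i, hi, h⟩ := hf M
    exact ⟨i + k, by omega, h⟩
  · have := hN (i - k) (by omega)
    simpa only [Nat.sub_add_cancel (by omega : k ≤ i)] using this

theorem WinningRegion.mem_of_play {S W : Set V} {p : Bool} {f : V → V}
    (h : WinningRegion E own c S p W f) {w : ℕ → V} {k : ℕ} (hk : w k ∈ W)
    (hS : ∀ i, w i ∈ S) (hE : ∀ i, E (w i) (w (i + 1)))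
    (hf : ∀ i, w i ∈ W → own (w i) = p → w (i + 1) = f (w i)) (i : ℕ) : w (i + k) ∈ W := by
  induction i with
  | zero => simpa using hk
  | succ i ih =>
    rw [Nat.add_right_comm]
    by_cases ho : own (w (i + k)) = p
    · rw [hf _ ih ho]
      exact (h.move _ ih ho).2
    · exact h.trap _ ih ho _ (hS _) (hE _)

theorem WinningRegion.won_of_reach {S W : Set V} {p : Bool} {f : V → V}
    (h : WinningRegion E own c S p W f) {w : ℕ → V} {k : ℕ} (hk : ∀ i, w (i + k) ∈ W)
    (hE : ∀ i, E (w i) (w (i + 1)))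
    (hf : ∀ i, w i ∈ W → own (w i) = p → w (i + 1) = f (w i)) : Won c p w := by
  refine Won.of_shift k (h.won _ hk (fun i => ?_) fun i ho => ?_)
  · rw [Nat.add_right_comm]
    exact hE _
  · rw [Nat.add_right_comm]
    exact hf _ (hk i) ho

variable (E own) in
/-- The vertices from which player `p` can force, inside `S`, a visit to `T` in at most `n`
steps. -/
def attractorStage (S T : Set V) (p : Bool) : ℕ → Set V
  | 0 => T
  | n + 1 => attractorStage S T p n ∪
      {v ∈ S | (own v = p ∧ ∃ u ∈ attractorStage S T p n, E v u) ∨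
        (own v ≠ p ∧ ∀ u ∈ S, E v u → u ∈ attractorStage S T p n)}

variable (E own) in
/-- `A` is the attractor of `T` for player `p` in `S`, with attracting strategy `g` and rank
function `r`. -/
structure IsAttractor (S T : Set V) (p : Bool) (A : Set V) (g : V → V) (r : V → ℕ) : Prop where
  target_subset : T ⊆ A
  subset : A ⊆ S
  move : ∀ v ∈ A, v ∉ T → own v = p → E v (g v) ∧ g v ∈ A ∧ r (g v) < r v
  trap : ∀ v ∈ A, v ∉ T → own v ≠ p → ∀ u ∈ S, E v u → u ∈ A ∧ r u < r v
  compl_trap : ∀ v ∈ S, v ∉ A → own v = p → ∀ u, E v u → u ∉ A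
  compl_move : ∀ v ∈ S, v ∉ A → own v ≠ p → ∃ u ∈ S, E v u ∧ u ∉ A

theorem exists_isAttractor [Finite V] {S T : Set V} (hT : T ⊆ S) (p : Bool) :
    ∃ A g r, IsAttractor E own S T p A g r := by
  classical
  let R := attractorStage E own S T p
  have hmono : Monotone R := monotone_nat_of_le_succ fun n => Set.subset_union_left
  have hRS : ∀ n, R n ⊆ S := by
    intro n
    induction n with
    | zero => exact hT
    | succ n ih => exact Set.union_subset ih fun v hv => hv.1
  let A : Set V := {v | ∃ n, v ∈ R n}
  let r : V → ℕ := fun v => sInf {n | v ∈ R n}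
  have hr : ∀ v ∈ A, v ∈ R (r v) := fun v hv => Nat.sInf_mem hv
  have hle : ∀ v n, v ∈ R n → r v ≤ n := fun v n h => Nat.sInf_le h
  have hstep : ∀ v ∈ A, v ∉ T → ∃ n, r v = n + 1 ∧
      ((own v = p ∧ ∃ u ∈ R n, E v u) ∨ (own v ≠ p ∧ ∀ u ∈ S, E v u → u ∈ R n)) := by
    intro v hv hvT
    have h := hr v hv
    rcases hn : r v with _ | n
    · rw [hn] at h
      exact absurd h hvT
    · rw [hn] at h
      rcases h with h | h
      · have := hle v n h
        omega
      · exact ⟨n, rfl, h.2⟩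
  have hg : ∀ v, ∃ u, v ∈ A → v ∉ T → own v = p → E v u ∧ u ∈ A ∧ r u < r v := by
    intro v
    by_cases h : v ∈ A ∧ v ∉ T ∧ own v = p
    · obtain ⟨n, hn, ⟨-, u, hu, hE⟩ | ⟨ho, -⟩⟩ := hstep v h.1 h.2.1
      · have := hle u n hu
        exact ⟨u, fun _ _ _ => ⟨hE, ⟨n, hu⟩, by omega⟩⟩
      · exact absurd h.2.2 ho
    · exact ⟨v, fun h₁ h₂ h₃ => absurd ⟨h₁, h₂, h₃⟩ h⟩
  choose g hg using hg
  refine ⟨A, g, r, fun v hv => ⟨0, hv⟩, fun v ⟨n, hn⟩ => hRS n hn, hg, ?_, ?_, ?_⟩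
  · intro v hv hvT ho u hu hE
    obtain ⟨n, hn, ⟨ho', -⟩ | ⟨-, h⟩⟩ := hstep v hv hvT
    · exact absurd ho' ho
    · have := hle u n (h u hu hE)
      exact ⟨⟨n, h u hu hE⟩, by omega⟩
  · rintro v hv hvA ho u hE ⟨n, hn⟩
    exact hvA ⟨n + 1, Or.inr ⟨hv, Or.inl ⟨ho, u, hn, hE⟩⟩⟩
  · intro v hv hvA ho
    by_contra! hcon
    obtain ⟨N, hN⟩ := (Set.finite_range r).bddAbove
    refine hvA ⟨N + 1, Or.inr ⟨hv, Or.inr ⟨ho, fun u hu hE => ?_⟩⟩⟩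
    exact hmono (hN ⟨u, rfl⟩) (hr u (hcon u hu hE))

theorem IsAttractor.exists_reach {S T A : Set V} {p : Bool} {g : V → V} {r : V → ℕ}
    (h : IsAttractor E own S T p A g r) {w : ℕ → V} (hS : ∀ i, w i ∈ S)
    (hE : ∀ i, E (w i) (w (i + 1)))
    (hg : ∀ i, w i ∈ A → w i ∉ T → own (w i) = p → w (i + 1) = g (w i))
    {i : ℕ} (hi : w i ∈ A) : ∃ j, i ≤ j ∧ w j ∈ T := by
  induction hn : r (w i) using Nat.strong_induction_on generalizing i with
  | _ n ih =>
    by_cases hT : w i ∈ T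
    · exact ⟨i, le_rfl, hT⟩
    have hnext : w (i + 1) ∈ A ∧ r (w (i + 1)) < r (w i) := by
      by_cases ho : own (w i) = p
      · rw [hg i hi hT ho]
        exact (h.move _ hi hT ho).2
      · exact h.trap _ hi hT ho _ (hS _) (hE _)
    obtain ⟨j, hj, hjT⟩ := ih _ (hn ▸ hnext.2) hnext.1 rfl
    exact ⟨j, by omega, hjT⟩

/-- The complement of an attractor is a subgame. -/
theorem IsAttractor.compl_subgame {S T A : Set V} {p : Bool} {g : V → V} {r : V → ℕ}
    (h : IsAttractor E own S T p A g r) (hS : ∀ v ∈ S, ∃ u ∈ S, E v u) :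
    ∀ v ∈ S \ A, ∃ u ∈ S \ A, E v u := by
  rintro v ⟨hv, hvA⟩
  by_cases ho : own v = p
  · obtain ⟨u, hu, hE⟩ := hS v hv
    exact ⟨u, ⟨hu, h.compl_trap v hv hvA ho u hE⟩, hE⟩
  · obtain ⟨u, hu, hE, huA⟩ := h.compl_move v hv hvA ho
    exact ⟨u, ⟨hu, huA⟩, hE⟩

/-- If the player of the maximal priority wins everywhere outside the attractor of the vertices of
maximal priority, then she wins everywhere. -/
theorem WinningRegion.extend_attractor {S A : Set V} {d : ℕ} {g f : V → V} {r : V → ℕ}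
    (hS : ∀ v ∈ S, ∃ u ∈ S, E v u) (hd : ∀ v ∈ S, c v ≤ d)
    (hA : IsAttractor E own S {v ∈ S | c v = d} d.bodd A g r)
    (hW : WinningRegion E own c (S \ A) d.bodd (S \ A) f) :
    ∃ f', WinningRegion E own c S d.bodd S f' := by
  classical
  have hs : ∀ v, ∃ u, v ∈ S → u ∈ S ∧ E v u := fun v => by
    by_cases hv : v ∈ S
    · obtain ⟨u, hu⟩ := hS v hv
      exact ⟨u, fun _ => hu⟩
    · exact ⟨v, fun h => absurd h hv⟩
  choose s hs using hs
  refine ⟨fun v => if v ∈ A then (if c v = d then s v else g v) else f v, subset_rfl, ?_,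
    fun _ _ _ u hu _ => hu, ?_⟩
  · intro v hv ho
    by_cases hvA : v ∈ A
    · by_cases hc : c v = d
      · simpa [hvA, hc] using (hs v hv).symm
      · have := hA.move v hvA (fun h => hc h.2) ho
        simpa [hvA, hc] using ⟨this.1, hA.subset this.2.1⟩
    · have := hW.move v ⟨hv, hvA⟩ ho
      simpa [hvA] using ⟨this.1, this.2.1⟩
  · intro w hwS hE hw
    by_cases hinf : ∀ N, ∃ i, N ≤ i ∧ w i ∈ A
    · refine ⟨d, rfl, fun N => ?_, 0, fun i _ => hd _ (hwS i)⟩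
      obtain ⟨i, hi, hiA⟩ := hinf N
      obtain ⟨j, hj, hjT⟩ := hA.exists_reach hwS hE (fun i hi hiT ho => by
        have hc : c (w i) ≠ d := fun h => hiT ⟨hwS i, h⟩
        simpa [hi, hc] using hw i ho) hiA
      exact ⟨j, by omega, hjT.2⟩
    · push Not at hinf
      obtain ⟨N, hN⟩ := hinf
      exact hW.won_of_reach (k := N) (fun i => ⟨hwS _, hN _ (by omega)⟩) hE
        fun i hi ho => by simpa [hi.2] using hw i ho

/-- A winning region of the subgame outside an opponent's attractor extends by its own attractor,
and by winning regions of what then remains. -/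
theorem WinningRegion.union_attractor {S A W B W' : Set V} {p : Bool} {T : Set V}
    {gA f g f' : V → V} {rA r : V → ℕ}
    (hA : IsAttractor E own S T (!p) A gA rA)
    (hW : WinningRegion E own c (S \ A) p W f)
    (hB : IsAttractor E own S W p B g r)
    (hW' : WinningRegion E own c (S \ B) p W' f') :
    ∃ f'', WinningRegion E own c S p (B ∪ W') f'' := by
  classical
  have hWtrap : ∀ v ∈ W, own v ≠ p → ∀ u ∈ S, E v u → u ∈ W := fun v hv ho u hu hE =>
    hW.trap v hv ho u ⟨hu, hA.compl_trap v (hW.subset hv).1 (hW.subset hv).2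
      (by simpa [Bool.eq_not] using ho) u hE⟩ hE
  have hWS : WinningRegion E own c S p W f :=
    ⟨hW.subset.trans Set.sdiff_subset, hW.move, hWtrap, hW.won⟩
  have hsub : B ∪ W' ⊆ S := Set.union_subset hB.subset (hW'.subset.trans Set.sdiff_subset)
  refine ⟨fun v => if v ∈ W then f v else if v ∈ B then g v else f' v, hsub, ?_, ?_, ?_⟩
  · intro v hv ho
    by_cases hvW : v ∈ W
    · have := hW.move v hvW ho
      simpa [hvW] using ⟨this.1, Or.inl (hB.target_subset this.2)⟩
    by_cases hvB : v ∈ B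
    · have := hB.move v hvB hvW ho
      simpa [hvW, hvB] using ⟨this.1, Or.inl this.2.1⟩
    · have := hW'.move v (hv.resolve_left hvB) ho
      simpa [hvW, hvB] using ⟨this.1, Or.inr this.2⟩
  · intro v hv ho u hu hE
    by_cases hvW : v ∈ W
    · exact Or.inl (hB.target_subset (hWtrap v hvW ho u hu hE))
    by_cases hvB : v ∈ B
    · exact Or.inl (hB.trap v hvB hvW ho u hu hE).1
    · by_cases huB : u ∈ B
      · exact Or.inl huB
      · exact Or.inr (hW'.trap v (hv.resolve_left hvB) ho u ⟨hu, huB⟩ hE)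
  · intro w hwm hE hw
    have hwS : ∀ i, w i ∈ S := fun i => hsub (hwm i)
    by_cases hvis : ∃ i, w i ∈ B
    · obtain ⟨i, hi⟩ := hvis
      obtain ⟨j, -, hj⟩ := hB.exists_reach hwS hE (fun i hi hiW ho => by
        simpa [hi, hiW] using hw i ho) hi
      have hf : ∀ i, w i ∈ W → own (w i) = p → w (i + 1) = f (w i) := fun i hi ho => by
        simpa [hi] using hw i ho
      exact hW.won_of_reach (hWS.mem_of_play hj hwS hE hf) hE hf
    · push Not at hvis
      refine hW'.won w (fun i => (hwm i).resolve_left (hvis i)) hE fun i ho => ?_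
      have : w i ∉ W := fun h => hvis i (hB.target_subset h)
      simpa [this, hvis i] using hw i ho

/-- Positional determinacy of parity games. -/
theorem exists_winningRegion_union [Finite V] (S : Set V) (hS : ∀ v ∈ S, ∃ u ∈ S, E v u)
    (p : Bool) :
    ∃ W f W' f', W ∪ W' = S ∧ WinningRegion E own c S p W f ∧
      WinningRegion E own c S (!p) W' f' := by
  induction S using WellFoundedLT.induction generalizing p with
  | _ S ih =>
  suffices ∃ q W f W' f', W ∪ W' = S ∧ WinningRegion E own c S q W f ∧
      WinningRegion E own c S (!q) W' f' by
    obtain ⟨q, W, f, W', f', hU, h, h'⟩ := this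
    by_cases hq : q = p
    · subst hq
      exact ⟨W, f, W', f', hU, h, h'⟩
    · obtain rfl : q = !p := Bool.eq_not.2 hq
      rw [Bool.not_not] at h'
      exact ⟨W', f', W, f, by rw [Set.union_comm, hU], h', h⟩
  have hempty : ∀ q, WinningRegion E own c S q ∅ id := fun q =>
    ⟨Set.empty_subset _, by simp, by simp, fun w hw => absurd (hw 0) (by simp)⟩
  rcases S.eq_empty_or_nonempty with rfl | hne
  · exact ⟨true, ∅, id, ∅, id, by simp, hempty _, hempty _⟩
  obtain ⟨v₀, hv₀, hmax⟩ := S.toFinite.exists_maximalFor c S hne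
  have hd : ∀ v ∈ S, c v ≤ c v₀ := fun v hv => (le_total (c v) (c v₀)).elim id (hmax hv)
  obtain ⟨A, g, r, hA⟩ := exists_isAttractor (E := E) (own := own)
    (Set.sep_subset S fun v => c v = c v₀) (c v₀).bodd
  obtain ⟨W, f, W', f', hU, hW, hW'⟩ := ih (S \ A)
    ⟨Set.sdiff_subset, fun h => (h hv₀).2 (hA.target_subset ⟨hv₀, rfl⟩)⟩ (hA.compl_subgame hS)
    (c v₀).bodd
  rcases W'.eq_empty_or_nonempty with rfl | ⟨x, hx⟩
  · rw [Set.union_empty] at hU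
    subst hU
    obtain ⟨f'', h⟩ := WinningRegion.extend_attractor hS hd hA hW
    exact ⟨_, S, f'', ∅, id, by simp, h, hempty _⟩
  · obtain ⟨B, gB, rB, hB⟩ := exists_isAttractor (E := E) (own := own)
      (hW'.subset.trans Set.sdiff_subset) (!(c v₀).bodd)
    obtain ⟨X, e, X', e', hU', hX, hX'⟩ := ih (S \ B)
      ⟨Set.sdiff_subset, fun h => (h (hW'.subset hx).1).2 (hB.target_subset hx)⟩
      (hB.compl_subgame hS) (c v₀).bodd
    obtain ⟨f'', h⟩ := WinningRegion.union_attractor (by rwa [Bool.not_not]) hW' hB hX'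
    refine ⟨_, X, e, B ∪ X', f'', ?_, ⟨hX.subset.trans Set.sdiff_subset, hX.move, ?_, hX.won⟩, h⟩
    · rw [Set.union_left_comm, hU', Set.union_sdiff_cancel hB.subset]
    · intro v hv ho u hu hE
      have hv' := hX.subset hv
      exact hX.trap v hv ho u
        ⟨hu, hB.compl_trap v hv'.1 hv'.2 (Bool.eq_not.2 ho) u hE⟩ hE

/-- Along a play in a winning region that follows the positional strategy, every cycle has maximal
priority of the winner's parity, since repeating the cycle forever is again such a play. -/
theorem WinningRegion.bodd_cycle {S W : Set V} {p : Bool} {f : V → V}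
    (h : WinningRegion E own c S p W f) {w : ℕ → V} (hW : ∀ i, w i ∈ W)
    (hE : ∀ i, E (w i) (w (i + 1))) (hf : ∀ i, own (w i) = p → w (i + 1) = f (w i))
    {i j : ℕ} (hij : i < j) (hw : w i = w j) :
    ((Finset.Icc i j).sup fun k => c (w k)).bodd = p := by
  obtain ⟨n, hn, rfl⟩ : ∃ n, 0 < n ∧ j = i + n := ⟨j - i, by omega, by omega⟩
  have hsucc : ∀ k, w (i + (k + 1) % n) = w (i + k % n + 1) := by
    intro k
    have hlt := Nat.mod_lt k hn
    rw [← Nat.mod_add_mod k n 1]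
    rcases (by omega : k % n + 1 < n ∨ k % n + 1 = n) with h | h
    · rw [Nat.mod_eq_of_lt h, Nat.add_assoc]
    · rw [Nat.add_assoc, h, Nat.mod_self, Nat.add_zero, hw]
  obtain ⟨m, hm, hinf, N, hN⟩ := h.won (fun k => w (i + k % n)) (fun k => hW _)
    (fun k => by simpa only [hsucc] using hE _) (fun k ho => by simpa only [hsucc] using hf _ ho)
  rw [← hm]
  congr 1
  apply le_antisymm
  · refine Finset.sup_le fun k hk => ?_
    rw [Finset.mem_Icc] at hk
    have key : ∀ t < n, c (w (i + t)) ≤ m := fun t ht => by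
      have := hN (N * n + t) (by nlinarith)
      simpa [Nat.mul_add_mod', Nat.mod_eq_of_lt ht] using this
    rcases (by omega : k - i < n ∨ k = i + n) with h | rfl
    · simpa only [Nat.add_sub_cancel' hk.1] using key _ h
    · rw [← hw]
      exact key 0 hn
  · obtain ⟨k, -, hk⟩ := hinf 0
    have hlt := Nat.mod_lt k hn
    rw [← hk]
    exact Finset.le_sup (f := fun k => c (w k)) (Finset.mem_Icc.2 ⟨by omega, by omega⟩)

end Positional

variable {G : ParityGame}

theorem bodd_sSup_of_won {p : Bool} {π : ℕ → G.V} (h : Won G.c p π) :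
    (sSup {q | ∀ N, ∃ i, N ≤ i ∧ G.c (π i) = q}).bodd = p := by
  obtain ⟨m, hm, hinf, N, hN⟩ := h
  have : IsGreatest {q | ∀ N, ∃ i, N ≤ i ∧ G.c (π i) = q} m := by
    refine ⟨hinf, fun q hq => ?_⟩
    obtain ⟨i, hi, rfl⟩ := hq N
    exact hN i hi
  rw [this.csSup_eq, hm]

theorem even_iff_bodd {n : ℕ} : Even n ↔ n.bodd = false := by
  rw [Nat.even_iff, Nat.mod_two_of_bodd]
  cases n.bodd <;> simp

theorem odd_iff_bodd {n : ℕ} : Odd n ↔ n.bodd = true := by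
  rw [← Nat.not_even_iff_odd, even_iff_bodd, Bool.not_eq_false]

/-- Auxiliary recursion for `exists_play`: the history together with the current vertex. -/
def playState (σ : EveStrategy G) (f : G.V → G.V) [DecidablePred (· ∈ G.EveV)] (v : G.V) :
    ℕ → List G.V × G.V
  | 0 => ([], v)
  | n + 1 =>
    let s := playState σ f v n
    (s.1 ++ [s.2], if s.2 ∈ G.EveV then σ.move s.1 s.2 else f s.2)

/-- Eve's strategy together with a positional strategy of Adam determines a play. -/
theorem exists_play (σ : EveStrategy G) (f : G.V → G.V) (v : G.V) :
    ∃ π : ℕ → G.V, π 0 = v ∧ G.ConsistentE σ π ∧ ∀ i, π i ∉ G.EveV → π (i + 1) = f (π i) := by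
  classical
  have hist : ∀ n, (playState σ f v n).1 =
      (List.range n).map fun i => (playState σ f v i).2 := by
    intro n
    induction n with
    | zero => rfl
    | succ n ih => rw [List.range_succ, List.map_append, ← ih]; rfl
  refine ⟨fun n => (playState σ f v n).2, rfl, fun i hi => ?_, fun i hi => ?_⟩
  · rw [← hist]
    exact if_pos hi
  · exact if_neg hi

/-- From every vertex, either Eve has a strategy winning the parity objective and closing only
even cycles, or against every strategy of hers some play violates the parity objective and closes
only odd cycles. -/
theorem eve_even_or_adam_odd (v : G.V) :
    (∃ σ : EveStrategy G, ∀ π, G.IsPlay v π → G.ConsistentE σ π →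
      G.SatParity π ∧ G.AllEvenCycles π) ∨
    ∀ σ : EveStrategy G, ∃ π, G.IsPlay v π ∧ G.ConsistentE σ π ∧
      ¬ G.SatParity π ∧ G.AllOddCycles π := by
  classical
  let own : G.V → Bool := fun v => decide (v ∉ G.EveV)
  obtain ⟨W, f, W', f', hU, hW, hW'⟩ := exists_winningRegion_union (E := G.E) (own := own)
    (c := G.c) Set.univ (fun v _ => by simpa using G.exists_succ v) false
  rcases hU.symm ▸ Set.mem_univ v with hv | hv
  · left
    choose s hs using G.exists_succ
    refine ⟨⟨fun _ u => if u ∈ W then f u else s u, fun _ u hu => ?_⟩, fun π hπ hσ => ?_⟩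
    · split_ifs with huW
      · exact (hW.move u huW (by simpa [own] using hu)).1
      · exact hs u
    · have hf : ∀ i, π i ∈ W → own (π i) = false → π (i + 1) = f (π i) := fun i hi ho => by
        simpa [hi] using hσ i (by simpa [own] using ho)
      have hm : ∀ i, π i ∈ W := by
        simpa using hW.mem_of_play (k := 0) (by rwa [hπ.1]) (fun _ => Set.mem_univ _) hπ.2 hf
      exact ⟨even_iff_bodd.2 (bodd_sSup_of_won (hW.won π hm hπ.2 fun i => hf i (hm i))),
        fun i j hij h => even_iff_bodd.2 (hW.bodd_cycle hm hπ.2 (fun i => hf i (hm i)) hij h)⟩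
  · right
    intro σ
    obtain ⟨π, h0, hσ, hf⟩ := exists_play σ f' v
    have hf' : ∀ i, own (π i) = !false → π (i + 1) = f' (π i) := fun i ho =>
      hf i (by simpa [own] using ho)
    have hstep : ∀ i, π i ∈ W' → G.E (π i) (π (i + 1)) ∧ π (i + 1) ∈ W' := by
      intro i hi
      by_cases he : π i ∈ G.EveV
      · have hE : G.E (π i) (π (i + 1)) := by
          rw [hσ i he]
          exact σ.follows _ _ he
        exact ⟨hE, hW'.trap _ hi (by simpa [own] using he) _ (Set.mem_univ _) hE⟩
      · rw [hf i he]
        exact hW'.move _ hi (by simpa [own] using he)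
    have hm : ∀ i, π i ∈ W' := fun i => by
      induction i with
      | zero => rwa [h0]
      | succ i ih => exact (hstep i ih).2
    have hE : ∀ i, G.E (π i) (π (i + 1)) := fun i => (hstep i (hm i)).1
    refine ⟨π, ⟨h0, hE⟩, hσ, fun h => ?_,
      fun i j hij h => odd_iff_bodd.2 (hW'.bodd_cycle hm hE hf' hij h)⟩
    have h₁ := bodd_sSup_of_won (hW'.won π hm hE hf')
    rw [even_iff_bodd.1 h] at h₁
    exact absurd h₁ (by decide)

end ParityGame

/-- Let `L ⊆ V^ω` be any set of infinite words over the vertex alphabet with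
`AllEvenCycles ⊆ L` and `L ∩ AllOddCycles = ∅`. Then from every vertex, Eve wins the parity
objective if and only if she wins the objective `L`. -/
theorem separating_language_same_winning_region (G : ParityGame) (hd : Even G.d)
    (L : Set (ℕ → G.V))
    (hEven : ∀ w : ℕ → G.V, G.AllEvenCycles w → w ∈ L)
    (hOdd : ∀ w ∈ L, ¬ G.AllOddCycles w) :
    ∀ v : G.V, G.EveWinsFrom v ↔ G.EveWinsObj (· ∈ L) v := by
  intro v
  rcases ParityGame.eve_even_or_adam_odd v with ⟨σ, hσ⟩ | h
  · exact iff_of_true ⟨σ, fun π hπ hc => (hσ π hπ hc).1⟩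
      ⟨σ, fun π hπ hc => hEven π (hσ π hπ hc).2⟩
  · refine iff_of_false ?_ ?_
    · rintro ⟨σ, hσ⟩
      obtain ⟨π, hπ, hc, hn, -⟩ := h σ
      exact hn (hσ π hπ hc)
    · rintro ⟨σ, hσ⟩
      obtain ⟨π, hπ, hc, -, ho⟩ := h σ
      exact hOdd π (hσ π hπ hc) ho
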